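/- (Margulis's Opposite Sign Lemma.) Equip ℝ³ with the Lorentzian bilinear form B(x,y) = x₁y₁ + x₂y₂ − x₃y₃. For i = 1, 2, let γ_i : x ↦ g_i x + u_i be an affine transformation of ℝ³ whose linear part g_i preserves B and is hyperbolic, i.e. has real eigenvalues λ_i, 1, λ_i^{-1} with 0 < λ_i < 1. Suppose given vectors x_i⁻, x_i⁺, x_i⁰ ∈ ℝ³ with g_i x_i⁻ = λ_i x_i⁻, g_i x_i⁺ = λ_i^{-1} x_i⁺, the third coordinates of x_i⁻ and x_i⁺ both positive (so they lie in the same component of the null cone), g_i x_i⁰ = x_i⁰, B(x_i⁰, x_i⁰) = 1, and det(x_i⁰, x_i⁻, x_i⁺) > 0; define the Margulis invariant α(γ_i) := B(u_i, x_i⁰). If the subgroup of Aff(ℝ³) generated by γ₁ and γ₂ acts properly discontinuously on ℝ³, then α(γ₁) and α(γ₂) are nonzero and have the same sign: α(γ₁)·α(γ₂) > 0. -/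

import Mathlib

/-- The Lorentzian bilinear form `B(x, y) = x₁y₁ + x₂y₂ − x₃y₃` on `ℝ³`. -/
def lorentzForm (x y : Fin 3 → ℝ) : ℝ :=
  x 0 * y 0 + x 1 * y 1 - x 2 * y 2

/-- The determinant of the `3 × 3` matrix with columns `a`, `b`, `c`. -/
def det3 (a b c : Fin 3 → ℝ) : ℝ :=
  Matrix.det (Matrix.of fun r s : Fin 3 => (![a, b, c] s) r)

/-- Affine boost data: `a` is the Margulis invariant, `l` the small eigenvalue. -/
structure Boost (f : (Fin 3 → ℝ) ≃ᵃ[ℝ] (Fin 3 → ℝ)) (a l : ℝ) (m p z : Fin 3 → ℝ) : Prop where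
  lor : ∀ x y : Fin 3 → ℝ, lorentzForm (f.linear x) (f.linear y) = lorentzForm x y
  lpos : 0 < l
  llt : l < 1
  hm : f.linear m = l • m
  hp : f.linear p = l⁻¹ • p
  hz : f.linear z = z
  m2 : 0 < m 2
  p2 : 0 < p 2
  zn : lorentzForm z z = 1
  hdet : 0 < det3 z m p
  inv : ∀ x, lorentzForm (f x - x) z = a

lemma lf_add (x y w : Fin 3 → ℝ) :
    lorentzForm (x + y) w = lorentzForm x w + lorentzForm y w := by
  simp [lorentzForm]; ring
lemma lf_sub (x y w : Fin 3 → ℝ) :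
    lorentzForm (x - y) w = lorentzForm x w - lorentzForm y w := by
  simp [lorentzForm]; ring
lemma lf_smul (c : ℝ) (x w : Fin 3 → ℝ) :
    lorentzForm (c • x) w = c * lorentzForm x w := by
  simp [lorentzForm]; ring
lemma lf_smul_right (c : ℝ) (x w : Fin 3 → ℝ) :
    lorentzForm x (c • w) = c * lorentzForm x w := by
  simp [lorentzForm]; ring
lemma lf_comm (x w : Fin 3 → ℝ) : lorentzForm x w = lorentzForm w x := by
  simp [lorentzForm]; ring

lemma det3_eq (a b c : Fin 3 → ℝ) : det3 a b c =
    a 0 * (b 1 * c 2 - b 2 * c 1) - a 1 * (b 0 * c 2 - b 2 * c 0)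
      + a 2 * (b 0 * c 1 - b 1 * c 0) := by
  simp [det3, Matrix.det_fin_three]; ring

lemma null_nonpos {a b : Fin 3 → ℝ} (ha : lorentzForm a a = 0) (hb : lorentzForm b b = 0)
    (ha2 : 0 < a 2) (hb2 : 0 < b 2) : lorentzForm a b ≤ 0 := by
  simp only [lorentzForm] at *
  have h1 : (a 0 * b 0 + a 1 * b 1) ^ 2 ≤ (a 2 * b 2) ^ 2 := by
    have : (a 2 * b 2) ^ 2 = (a 0 ^ 2 + a 1 ^ 2) * (b 0 ^ 2 + b 1 ^ 2) := by
      have e1 : a 2 ^ 2 = a 0 ^ 2 + a 1 ^ 2 := by linarith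
      have e2 : b 2 ^ 2 = b 0 ^ 2 + b 1 ^ 2 := by linarith
      rw [mul_pow, e1, e2]
    rw [this]
    nlinarith [sq_nonneg (a 0 * b 1 - a 1 * b 0)]
  have := abs_le_of_sq_le_sq' h1 (by positivity)
  linarith [this.2]

namespace Boost
variable {f : (Fin 3 → ℝ) ≃ᵃ[ℝ] (Fin 3 → ℝ)} {a l : ℝ} {m p z : Fin 3 → ℝ}

lemma mm (h : Boost f a l m p z) : lorentzForm m m = 0 := by
  have := h.lor m m
  rw [h.hm, lf_smul, lf_smul_right] at this
  have h1 := h.lpos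
  have h2 := h.llt
  have h3 : (1 - l * l) * lorentzForm m m = 0 := by linarith
  rcases mul_eq_zero.1 h3 with h4 | h4
  · nlinarith
  · exact h4

lemma pp (h : Boost f a l m p z) : lorentzForm p p = 0 := by
  have := h.lor p p
  have h1 := h.lpos
  have h2 := h.llt
  rw [h.hp, lf_smul, lf_smul_right] at this
  have h3 : (1 - l * l) * lorentzForm p p = 0 := by
    field_simp at this
    linarith
  rcases mul_eq_zero.1 h3 with h4 | h4
  · nlinarith
  · exact h4

lemma zm (h : Boost f a l m p z) : lorentzForm z m = 0 := by
  have := h.lor z m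
  rw [h.hm, h.hz, lf_smul_right] at this
  have h2 := h.llt
  have h3 : (1 - l) * lorentzForm z m = 0 := by linarith
  rcases mul_eq_zero.1 h3 with h4 | h4
  · linarith
  · exact h4

lemma det_eq (h : Boost f a l m p z) (x : Fin 3 → ℝ) : det3 z m x = - lorentzForm m x := by
  have hmm := h.mm
  have hzm := h.zm
  have hzn := h.zn
  have hm2 := h.m2
  set μ : ℝ := -(z 0 * m 1 - z 1 * m 0) / m 2 with hμ
  have hw2 : -(z 0 * m 1 - z 1 * m 0) = μ * m 2 := by
    rw [hμ]; field_simp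
  have key : ∀ x, det3 z m x = μ * lorentzForm m x := by
    intro x
    have h0 : z 1 * m 2 - z 2 * m 1 = μ * m 0 := by
      apply mul_right_cancel₀ hm2.ne'
      have : μ * m 0 * m 2 = -(z 0 * m 1 - z 1 * m 0) * m 0 := by rw [hw2]; ring
      rw [this]
      simp only [lorentzForm] at *
      linear_combination m 1 * hzm - z 1 * hmm
    have h1 : z 2 * m 0 - z 0 * m 2 = μ * m 1 := by
      apply mul_right_cancel₀ hm2.ne'
      have : μ * m 1 * m 2 = -(z 0 * m 1 - z 1 * m 0) * m 1 := by rw [hw2]; ring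
      rw [this]
      simp only [lorentzForm] at *
      linear_combination - m 0 * hzm + z 0 * hmm
    rw [det3_eq, lorentzForm]
    linear_combination x 0 * h0 + x 1 * h1 - x 2 * hw2
  have hμ2 : μ ^ 2 = 1 := by
    apply mul_right_cancel₀ (pow_ne_zero 2 hm2.ne')
    have : μ ^ 2 * m 2 ^ 2 = (-(z 0 * m 1 - z 1 * m 0)) ^ 2 := by rw [hw2]; ring
    rw [this]
    simp only [lorentzForm] at *
    have e1 : z 0 * m 0 + z 1 * m 1 = z 2 * m 2 := by linarith
    have e2 : m 0 * m 0 + m 1 * m 1 = m 2 * m 2 := by linarith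
    have e3 : z 0 * z 0 + z 1 * z 1 = 1 + z 2 * z 2 := by linarith
    have : (-(z 0 * m 1 - z 1 * m 0)) ^ 2 = (z 0 * z 0 + z 1 * z 1) * (m 0 * m 0 + m 1 * m 1)
      - (z 0 * m 0 + z 1 * m 1) ^ 2 := by ring
    rw [this, e1, e2, e3]; ring
  have hd := h.hdet
  have hn := null_nonpos hmm h.pp hm2 h.p2
  rw [key] at hd
  have hμn : μ < 0 := by
    by_contra hc
    push Not at hc
    nlinarith
  have : μ = -1 := by
    have : (μ - 1) * (μ + 1) = 0 := by linear_combination hμ2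
    rcases mul_eq_zero.1 this with h4 | h4 <;> linarith
  rw [key, this]; ring

lemma mp_neg (h : Boost f a l m p z) : lorentzForm m p < 0 := by
  have := h.hdet
  rw [h.det_eq] at this
  linarith

/-- The orthogonal of `m` is spanned by `z` and `m`. -/
lemma span (h : Boost f a l m p z) {w : Fin 3 → ℝ} (hw : lorentzForm w m = 0) :
    ∃ c : ℝ, w = lorentzForm w z • z + c • m := by
  have hd := h.hdet
  have h0 := h.det_eq w
  rw [lf_comm, hw, neg_zero] at h0
  have hs : w = (det3 w m p / det3 z m p) • z + (det3 z w p / det3 z m p) • m := by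
    have : det3 z m p • w = det3 w m p • z + det3 z w p • m + det3 z m w • p := by
      ext i
      simp only [det3_eq, Pi.add_apply, Pi.smul_apply, smul_eq_mul]
      fin_cases i <;> simp <;> ring
    rw [h0, zero_smul, add_zero] at this
    rw [div_eq_inv_mul, div_eq_inv_mul, mul_smul, mul_smul, ← smul_add, ← this, smul_smul,
      inv_mul_cancel₀ hd.ne', one_smul]
  have hsz : lorentzForm w z = det3 w m p / det3 z m p := by
    conv_lhs => rw [hs]
    rw [lf_add, lf_smul, lf_smul, h.zn, lf_comm m z, h.zm]; ring
  exact ⟨_, by rw [hsz]; exact hs⟩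

lemma plane (h : Boost f a l m p z) : ∃ β : ℝ, ∀ q, lorentzForm q m = β →
    ∃ c : ℝ, f q = q + a • z + c • m := by
  have hl := h.lpos
  have hl1 := h.llt
  refine ⟨- lorentzForm (f 0) m / (l⁻¹ - 1), fun q hq => ?_⟩
  have hfq : f q = f.linear q + f 0 := by
    have := f.map_vadd 0 q
    simpa using this
  have hne : l⁻¹ - 1 ≠ 0 := by
    have := (one_lt_inv₀ hl).2 hl1
    linarith
  have hlin : lorentzForm (f.linear q) m = l⁻¹ * lorentzForm q m := by
    have := h.lor q m
    rw [h.hm, lf_smul_right] at this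
    rw [← this]; field_simp
  have h0 : lorentzForm (f q - q) m = 0 := by
    rw [lf_sub, hfq, lf_add, hlin]
    have : (l⁻¹ - 1) * lorentzForm q m = - lorentzForm (f 0) m := by
      rw [hq, mul_div_cancel₀ _ hne]
    linarith
  obtain ⟨c, hc⟩ := h.span h0
  rw [h.inv] at hc
  exact ⟨c, by rw [add_assoc, ← hc]; abel⟩

lemma pow_m (h : Boost f a l m p z) (n : ℕ) : (f ^ n).linear m = l ^ n • m := by
  induction n with
  | zero => simp; rfl
  | succ n ih =>
    rw [pow_succ]
    change (f ^ n).linear (f.linear m) = _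
    rw [h.hm, map_smul, ih, smul_smul, pow_succ, mul_comm]

lemma pow_lor (h : Boost f a l m p z) (n : ℕ) (x y : Fin 3 → ℝ) :
    lorentzForm ((f ^ n).linear x) ((f ^ n).linear y) = lorentzForm x y := by
  induction n generalizing x y with
  | zero => rfl
  | succ n ih =>
    rw [pow_succ]
    change lorentzForm ((f ^ n).linear (f.linear x)) ((f ^ n).linear (f.linear y)) = _
    rw [ih, h.lor]

lemma step (h : Boost f a l m p z) {q : Fin 3 → ℝ} {c : ℝ} (hq : f q = q + a • z + c • m)
    (s b : ℝ) : f (q + s • z + b • m) = q + (s + a) • z + (c + l * b) • m := by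
  have := f.map_vadd q (s • z + b • m)
  simp only [vadd_eq_add, map_add, map_smul, h.hz, h.hm, hq] at this
  rw [show q + s • z + b • m = s • z + b • m + q by abel]
  rw [this]
  module

lemma iter (h : Boost f a l m p z) {q : Fin 3 → ℝ} {c : ℝ} (hq : f q = q + a • z + c • m)
    (n : ℕ) (s b : ℝ) : ∃ b' : ℝ, |b'| ≤ l ^ n * |b| + |c| / (1 - l) ∧
      (f ^ n) (q + s • z + b • m) = q + (s + n * a) • z + b' • m := by
  have hl := h.lpos
  have hl1 : 0 < 1 - l := by linarith [h.llt]
  induction n with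
  | zero =>
    refine ⟨b, ?_, ?_⟩
    · simp only [pow_zero, one_mul, le_add_iff_nonneg_right]; positivity
    · simp
  | succ n ih =>
    obtain ⟨b', h1, h2⟩ := ih
    refine ⟨c + l * b', ?_, ?_⟩
    · calc |c + l * b'| ≤ |c| + l * |b'| := by
            refine (abs_add_le _ _).trans ?_
            rw [abs_mul, abs_of_pos hl]
        _ ≤ |c| + l * (l ^ n * |b| + |c| / (1 - l)) := by gcongr
        _ = _ := by field_simp; ring
    · rw [pow_succ']
      change f ((f ^ n) _) = _
      rw [h2, h.step hq]
      push_cast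
      congr 3
      ring

lemma symm (h : Boost f a l m p z) : Boost f⁻¹ a l p m (-z) := by
  have hl := h.lpos
  have hinv : ∀ x, f⁻¹.linear (f.linear x) = x := fun x => by
    change f.linear.symm (f.linear x) = x
    simp
  have hinv2 : ∀ x, f.linear (f⁻¹.linear x) = x := fun x => by
    change f.linear (f.linear.symm x) = x
    simp
  refine ⟨?_, hl, h.llt, ?_, ?_, ?_, h.p2, h.m2, ?_, ?_, ?_⟩
  · intro x y
    rw [← h.lor, hinv2, hinv2]
  · have := hinv p
    rw [h.hp, map_smul] at this
    rw [← this, smul_smul, mul_inv_cancel₀ hl.ne', one_smul, this]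
  · have := hinv m
    rw [h.hm, map_smul] at this
    rw [← this, smul_smul, inv_mul_cancel₀ hl.ne', one_smul, this]
  · rw [map_neg]
    have := hinv z
    rw [h.hz] at this
    rw [this]
  · have := h.zn
    simp only [lorentzForm, Pi.neg_apply] at *
    linarith
  · have := h.hdet
    simp only [det3_eq, Pi.neg_apply] at *
    linarith
  · intro x
    have := h.inv (f⁻¹ x)
    have hx : f (f⁻¹ x) = x := f.apply_symm_apply x
    rw [hx] at this
    simp only [lorentzForm, Pi.neg_apply, Pi.sub_apply] at *
    linarith

end Boost

lemma mul_pow_bdd {l : ℝ} (h0 : 0 < l) (h1 : l < 1) : ∃ C : ℝ, ∀ n : ℕ, l ^ n * n ≤ C := by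
  have := (tendsto_self_mul_const_pow_of_lt_one h0.le h1).bddAbove_range
  obtain ⟨C, hC⟩ := this
  refine ⟨C, fun n => ?_⟩
  rw [mul_comm]
  exact hC ⟨n, rfl⟩

/-- The family of candidate compact sets. -/
def slab (q z m : Fin 3 → ℝ) (S R : ℝ) : Set (Fin 3 → ℝ) :=
  Set.image (fun t : ℝ × ℝ => q + t.1 • z + t.2 • m) (Set.Icc (-S) S ×ˢ Set.Icc (-R) R)

lemma slab_compact (q z m : Fin 3 → ℝ) (S R : ℝ) : IsCompact (slab q z m S R) :=
  (isCompact_Icc.prod isCompact_Icc).image (by fun_prop)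

lemma slab_mem (q z m : Fin 3 → ℝ) {S R s b : ℝ} (hs : |s| ≤ S) (hb : |b| ≤ R) :
    q + s • z + b • m ∈ slab q z m S R :=
  ⟨(s, b), ⟨abs_le.1 hs, abs_le.1 hb⟩, rfl⟩

lemma zero_case {f : (Fin 3 → ℝ) ≃ᵃ[ℝ] (Fin 3 → ℝ)} {a l : ℝ} {m p z : Fin 3 → ℝ}
    (h : Boost f a l m p z) (G : Subgroup ((Fin 3 → ℝ) ≃ᵃ[ℝ] (Fin 3 → ℝ))) (hf : f ∈ G)
    (hproper : ∀ K L : Set (Fin 3 → ℝ), IsCompact K → IsCompact L →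
      {δ : (Fin 3 → ℝ) ≃ᵃ[ℝ] (Fin 3 → ℝ) | δ ∈ G ∧ ∃ x ∈ K, δ x ∈ L}.Finite) : a ≠ 0 := by
  rintro rfl
  obtain ⟨β, hβ⟩ := h.plane
  have hmp := h.mp_neg
  obtain ⟨c, hc⟩ := hβ ((β / lorentzForm m p) • p) (by
    rw [lf_smul, lf_comm p m]; exact div_mul_cancel₀ _ hmp.ne)
  set q := (β / lorentzForm m p) • p
  have hl1 : 1 - l ≠ 0 := by linarith [h.llt]
  have hfix := h.step hc 0 (c / (1 - l))
  have e : c + l * (c / (1 - l)) = c / (1 - l) := by field_simp; ring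
  rw [e, add_zero] at hfix
  set y := q + (0:ℝ) • z + (c / (1 - l)) • m
  have hfixn : ∀ n : ℕ, (f ^ n) y = y := by
    intro n
    induction n with
    | zero => rfl
    | succ n ih =>
      rw [pow_succ']
      change f ((f ^ n) y) = y
      rw [ih, hfix]
  refine Set.infinite_of_injective_forall_mem (f := fun n : ℕ => f ^ n) ?_ ?_
    (hproper {y} {y} isCompact_singleton isCompact_singleton)
  · intro n n' hn
    have h1 := h.pow_m n
    have h2 := h.pow_m n'
    simp only at hn
    rw [hn, h2] at h1
    have h3 := congrFun h1 2
    simp only [Pi.smul_apply, smul_eq_mul] at h3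
    have h4 := mul_right_cancel₀ h.m2.ne' h3
    exact ((pow_right_strictAnti₀ h.lpos h.llt).injective h4).symm
  · intro n
    exact ⟨G.pow_mem hf n, y, rfl, hfixn n⟩

lemma core {f k : (Fin 3 → ℝ) ≃ᵃ[ℝ] (Fin 3 → ℝ)} {a l a' l' : ℝ}
    {m p z m' p' z' : Fin 3 → ℝ}
    (h : Boost f a l m p z) (h' : Boost k a' l' m' p' z') (hB : lorentzForm m m' ≠ 0)
    (haa : a * a' < 0)
    (G : Subgroup ((Fin 3 → ℝ) ≃ᵃ[ℝ] (Fin 3 → ℝ))) (hf : f ∈ G) (hk : k ∈ G)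
    (hproper : ∀ K L : Set (Fin 3 → ℝ), IsCompact K → IsCompact L →
      {δ : (Fin 3 → ℝ) ≃ᵃ[ℝ] (Fin 3 → ℝ) | δ ∈ G ∧ ∃ x ∈ K, δ x ∈ L}.Finite) : False := by
  have hB' : lorentzForm m' m ≠ 0 := by rwa [lf_comm]
  obtain ⟨β, hβ⟩ := h.plane
  obtain ⟨β', hβ'⟩ := h'.plane
  set q : Fin 3 → ℝ := (β' / lorentzForm m m') • m + (β / lorentzForm m' m) • m' with hq
  obtain ⟨c, hc⟩ := hβ q (by
    rw [hq, lf_add, lf_smul, lf_smul, h.mm]; field_simp; ring)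
  obtain ⟨c', hc'⟩ := hβ' q (by
    rw [hq, lf_add, lf_smul, lf_smul, h'.mm]; field_simp; ring)
  obtain ⟨v, hvm, hvm', hvz, hvz'⟩ : ∃ v : Fin 3 → ℝ, lorentzForm v m = 0 ∧
      lorentzForm v m' = 0 ∧ lorentzForm v z = 1 ∧ lorentzForm v z' = -1 := by
    let w : Fin 3 → ℝ := ![m 1 * m' 2 - m 2 * m' 1, m 2 * m' 0 - m 0 * m' 2,
      -(m 0 * m' 1 - m 1 * m' 0)]
    have hw : ∀ x, lorentzForm w x = det3 x m m' := by
      intro x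
      rw [det3_eq]
      simp [lorentzForm, w]; ring
    refine ⟨(-(lorentzForm m m')⁻¹) • w, ?_, ?_, ?_, ?_⟩
    · rw [lf_smul, hw, det3_eq]; ring
    · rw [lf_smul, hw, det3_eq]; ring
    · rw [lf_smul, hw, h.det_eq]; field_simp
    · rw [lf_smul, hw]
      have : det3 z' m m' = - det3 z' m' m := by rw [det3_eq, det3_eq]; ring
      rw [this, h'.det_eq, lf_comm m' m]; field_simp
  obtain ⟨d, hd⟩ := h.span hvm
  obtain ⟨d', hd'⟩ := h'.span hvm'
  rw [hvz] at hd
  rw [hvz'] at hd'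
  have ha : a ≠ 0 := by rintro rfl; simp at haa
  have hr : 0 < -a' / a := by
    have : -a' / a = -(a * a') / a ^ 2 := by field_simp
    rw [this]
    apply div_pos <;> [linarith; positivity]
  set r := -a' / a with hrdef
  have hra : r * a = -a' := by rw [hrdef]; field_simp
  let M : ℕ → ℕ := fun n => ⌈n * r⌉₊
  have hM1 : ∀ n : ℕ, n * r ≤ M n := fun n => Nat.le_ceil _
  have hM2 : ∀ n : ℕ, (M n : ℝ) < n * r + 1 := fun n => Nat.ceil_lt_add_one (by positivity)
  have hMmono : Monotone M := fun n n' hn => Nat.ceil_mono (by gcongr)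
  have hbd : ∀ n : ℕ, |(M n : ℝ) * a + n * a'| ≤ |a| := by
    intro n
    have : (M n : ℝ) * a + n * a' = (M n - n * r) * a := by linear_combination (n:ℝ) * hra
    rw [this, abs_mul]
    have : |(M n : ℝ) - n * r| ≤ 1 := by
      rw [abs_le]; constructor <;> linarith [hM1 n, hM2 n]
    nlinarith [abs_nonneg a]
  obtain ⟨C, hC⟩ := mul_pow_bdd h.lpos h.llt
  obtain ⟨C', hC'⟩ := mul_pow_bdd h'.lpos h'.llt
  have hL := slab_compact q z m 0 (C * |a * d| + |c| / (1 - l))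
  have hK := slab_compact q z' m' |a| ((C' * r + 1) * |a * d'| + |c'| / (1 - l'))
  refine Set.infinite_of_injective_forall_mem
    (f := fun n : ℕ => f ^ M n * (k ^ n)⁻¹) ?_ ?_ (hproper _ _ hK hL)
  · have key : ∀ n : ℕ, l' ^ n * l ^ M n *
        lorentzForm ((f ^ M n * (k ^ n)⁻¹).linear m') m = lorentzForm m' m := by
      intro n
      have e1 : (f ^ M n * (k ^ n)⁻¹).linear ((k ^ n).linear m') = (f ^ M n).linear m' := by
        have : f ^ M n = f ^ M n * (k ^ n)⁻¹ * k ^ n := by simp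
        conv_rhs => rw [this]
        rfl
      rw [h'.pow_m, map_smul] at e1
      have e2 := h.pow_lor (M n) m' m
      rw [← e1, h.pow_m, lf_smul, lf_smul_right] at e2
      linarith
    have hanti : StrictAnti fun n : ℕ => l' ^ n * l ^ M n := by
      intro n n' hn
      have e1 := pow_lt_pow_right_of_lt_one₀ h'.lpos h'.llt hn
      have e2 := pow_le_pow_of_le_one h.lpos.le h.llt.le (hMmono hn.le)
      exact mul_lt_mul e1 e2 (pow_pos h.lpos _) (pow_pos h'.lpos _).le
    intro n n' hn
    apply hanti.injective
    have k1 := key n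
    have k2 := key n'
    simp only at hn
    rw [hn] at k1
    simp only
    rw [← k2] at k1
    refine mul_right_cancel₀ ?_ k1
    intro h0
    rw [h0, mul_zero] at k2
    exact hB' k2.symm
  · intro n
    refine ⟨G.mul_mem (G.pow_mem hf _) (G.inv_mem (G.pow_mem hk _)), ?_⟩
    set t : ℝ := -(M n * a) with ht
    have y1 : q + t • v = q + t • z + (t * d) • m := by rw [hd]; module
    have y2 : q + t • v = q + (-t) • z' + (t * d') • m' := by rw [hd']; module
    obtain ⟨b, hb, hb2⟩ := h.iter hc (M n) t (t * d)
    obtain ⟨b', hb', hb2'⟩ := h'.iter hc' n (-t) (t * d')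
    rw [← y1] at hb2
    rw [← y2] at hb2'
    refine ⟨(k ^ n) (q + t • v), ?_, ?_⟩
    · rw [hb2']
      apply slab_mem
      · rw [ht, neg_neg]; exact hbd n
      · refine hb'.trans ?_
        have e : |t * d'| = M n * |a * d'| := by
          rw [ht, show -(M n * a) * d' = -(M n * (a * d')) by ring, abs_neg, abs_mul,
            Nat.abs_cast]
        rw [e, ← mul_assoc]
        have hpn : l' ^ n ≤ 1 := pow_le_one₀ h'.lpos.le h'.llt.le
        have hpp : 0 < l' ^ n := pow_pos h'.lpos n
        have : l' ^ n * M n ≤ C' * r + 1 := by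
          have := mul_le_mul_of_nonneg_left (hM2 n).le hpp.le
          have := mul_le_mul_of_nonneg_right (hC' n) hr.le
          nlinarith
        gcongr
    · have e0 : (f ^ M n * (k ^ n)⁻¹) ((k ^ n) (q + t • v)) = (f ^ M n) (q + t • v) := by
        change (f ^ M n) ((k ^ n).symm ((k ^ n) (q + t • v))) = _
        rw [AffineEquiv.symm_apply_apply]
      change (f ^ M n * (k ^ n)⁻¹) ((k ^ n) (q + t • v)) ∈ _
      rw [e0, hb2]
      apply slab_mem
      · rw [ht]; simp
      · refine hb.trans ?_
        have e : |t * d| = M n * |a * d| := by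
          rw [ht, show -(M n * a) * d = -(M n * (a * d)) by ring, abs_neg, abs_mul,
            Nat.abs_cast]
        rw [e, ← mul_assoc]
        gcongr
        exact hC _

/-- Margulis's Opposite Sign Lemma: if two affine boosts `γ₀, γ₁` of Minkowski
`ℝ³` (affine transformations with hyperbolic Lorentz linear part) generate a
group acting properly discontinuously on `ℝ³`, then their Margulis invariants
`α(γᵢ) = B(uᵢ, xᵢ⁰)` are nonzero and of the same sign. -/
theorem margulis_opposite_sign_lemma
    (γ : Fin 2 → ((Fin 3 → ℝ) ≃ᵃ[ℝ] (Fin 3 → ℝ)))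
    (u : Fin 2 → (Fin 3 → ℝ)) (lam : Fin 2 → ℝ)
    (xm xp x0 : Fin 2 → (Fin 3 → ℝ))
    (haff : ∀ i, ∀ x : Fin 3 → ℝ, γ i x = (γ i).linear x + u i)
    (hlorentz : ∀ i, ∀ x y : Fin 3 → ℝ,
      lorentzForm ((γ i).linear x) ((γ i).linear y) = lorentzForm x y)
    (hlam : ∀ i, 0 < lam i ∧ lam i < 1)
    (hxm : ∀ i, (γ i).linear (xm i) = lam i • xm i)
    (hxp : ∀ i, (γ i).linear (xp i) = (lam i)⁻¹ • xp i)
    (hxm2 : ∀ i, 0 < xm i 2) (hxp2 : ∀ i, 0 < xp i 2)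
    (hx0 : ∀ i, (γ i).linear (x0 i) = x0 i)
    (hx0norm : ∀ i, lorentzForm (x0 i) (x0 i) = 1)
    (hdet : ∀ i, 0 < det3 (x0 i) (xm i) (xp i))
    (hproper : ∀ K L : Set (Fin 3 → ℝ), IsCompact K → IsCompact L →
      {δ : (Fin 3 → ℝ) ≃ᵃ[ℝ] (Fin 3 → ℝ) |
        δ ∈ Subgroup.closure {γ 0, γ 1} ∧ ∃ x ∈ K, δ x ∈ L}.Finite) :
    0 < lorentzForm (u 0) (x0 0) * lorentzForm (u 1) (x0 1) := by
  have hb : ∀ i, Boost (γ i) (lorentzForm (u i) (x0 i)) (lam i) (xm i) (xp i) (x0 i) := by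
    intro i
    refine ⟨hlorentz i, (hlam i).1, (hlam i).2, hxm i, hxp i, hx0 i, hxm2 i, hxp2 i,
      hx0norm i, hdet i, ?_⟩
    intro x
    have := hlorentz i x (x0 i)
    rw [hx0] at this
    rw [lf_sub, haff, lf_add, this]; ring
  have h0mem : γ 0 ∈ Subgroup.closure {γ 0, γ 1} := Subgroup.subset_closure (by simp)
  have h1mem : γ 1 ∈ Subgroup.closure {γ 0, γ 1} := Subgroup.subset_closure (by simp)
  have n0 := zero_case (hb 0) _ h0mem hproper
  have n1 := zero_case (hb 1) _ h1mem hproper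
  by_contra hc
  have hneg := lt_of_le_of_ne (not_lt.1 hc) (mul_ne_zero n0 n1)
  by_cases hB : lorentzForm (xm 0) (xm 1) = 0
  · by_cases hB' : lorentzForm (xm 0) (xp 1) = 0
    · obtain ⟨c, hcc⟩ := (hb 1).span hB
      set s := lorentzForm (xm 0) (x0 1) with hs
      have hnull := (hb 0).mm
      have e1 : lorentzForm (xm 0) (xm 0) = s * s := by
        conv_lhs => arg 1; rw [hcc]
        rw [lf_add, lf_smul, lf_smul, lf_comm (xm 1), hB, lf_comm (x0 1), ← hs]; ring
      rw [e1] at hnull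
      have hs0 : s = 0 := by simpa using hnull
      rw [hs0, zero_smul, zero_add] at hcc
      rw [hcc, lf_smul] at hB'
      have hc0 : c = 0 := by
        rcases mul_eq_zero.1 hB' with h | h
        · exact h
        · exact absurd h (hb 1).mp_neg.ne
      have := hxm2 0
      rw [hcc, hc0] at this
      simp at this
    · exact core (hb 0) (hb 1).symm hB' hneg _ h0mem (Subgroup.inv_mem _ h1mem) hproper
  · exact core (hb 0) (hb 1) hB hneg _ h0mem h1mem hproper
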